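/- For all vectors u, v, y, w ∈ ℝ⁸, with A = ⟨u,y⟩⟨v,w⟩ − ⟨u,w⟩⟨v,y⟩ and B = Φ₀(u,v,y,w), the following identity of 8-forms holds: (u♭ ∧ v♭) ∧ (ι_y Φ₀) ∧ (ι_w Φ₀) = (−4A + 2B) · vol. -/

import Mathlib

noncomputable section
open scoped RealInnerProductSpace

/-- Euclidean 8-space ℝ⁸. -/
abbrev E8 : Type := EuclideanSpace ℝ (Fin 8)

/-- The alternating 4-form `dx^i ∧ dx^j ∧ dx^k ∧ dx^l` on ℝ⁸, evaluated on four vectors. -/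
def dx4 (i j k l : Fin 8) (v : Fin 4 → E8) : ℝ :=
  Matrix.det (Matrix.of fun a b => v b (![i, j, k, l] a))

/-- The Cayley 4-form `Φ₀` on ℝ⁸ (indices written 0-based, i.e. `dx4 0 1 2 3` is `dx¹²³⁴`). -/
def Phi0 (v : Fin 4 → E8) : ℝ :=
  dx4 0 1 2 3 v + dx4 0 1 4 5 v + dx4 0 1 6 7 v + dx4 0 2 4 6 v
    - dx4 0 2 5 7 v - dx4 0 3 4 7 v - dx4 0 3 5 6 v
    - dx4 1 2 4 7 v - dx4 1 2 5 6 v - dx4 1 3 4 6 v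
    + dx4 1 3 5 7 v + dx4 2 3 4 5 v + dx4 2 3 6 7 v + dx4 4 5 6 7 v

/-- The wedge product of a `p`-form and a `q`-form on ℝ⁸ (forms represented as
functions of tuples of vectors), in the determinant convention: for alternating
`f` and `g` this is the usual exterior product, with `dx¹ ∧ ⋯ ∧ dx⁸ = vol`. -/
def wedge {p q : ℕ} (f : (Fin p → E8) → ℝ) (g : (Fin q → E8) → ℝ)
    (v : Fin (p + q) → E8) : ℝ :=
  ((p.factorial * q.factorial : ℕ) : ℝ)⁻¹ *
    ∑ σ : Equiv.Perm (Fin (p + q)),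
      ((Equiv.Perm.sign σ : ℤ) : ℝ) *
        ((f fun i => v (σ (Fin.castAdd q i))) * g fun j => v (σ (Fin.natAdd p j)))

/-- The standard volume form `vol = dx¹ ∧ ⋯ ∧ dx⁸` on ℝ⁸. -/
def vol (v : Fin 8 → E8) : ℝ := Matrix.det (Matrix.of fun a b => v b a)

/-- The 1-form `u♭ = ⟨u, ·⟩`. -/
def flat (u : E8) (v : Fin 1 → E8) : ℝ := ⟪u, v 0⟫

/-- The contraction 3-form `ι_u Φ₀ = Φ₀(u, ·, ·, ·)`. -/
def iota1 (u : E8) (z : Fin 3 → E8) : ℝ := Phi0 ![u, z 0, z 1, z 2]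

/-- The 3-form `ι_{e_k} Φ₀` as a list of signed monomials: the entry `(c, i, j, l)` of
`contractionTerms k` stands for `c dx^i ∧ dx^j ∧ dx^l`. -/
def contractionTerms : Fin 8 → List (ℤ × Fin 8 × Fin 8 × Fin 8) :=
  ![[(1, 1, 2, 3), (1, 1, 4, 5), (1, 1, 6, 7), (1, 2, 4, 6), (-1, 2, 5, 7), (-1, 3, 4, 7), (-1, 3, 5, 6)],
    [(-1, 0, 2, 3), (-1, 0, 4, 5), (-1, 0, 6, 7), (-1, 2, 4, 7), (-1, 2, 5, 6), (-1, 3, 4, 6), (1, 3, 5, 7)],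
    [(1, 0, 1, 3), (-1, 0, 4, 6), (1, 0, 5, 7), (1, 1, 4, 7), (1, 1, 5, 6), (1, 3, 4, 5), (1, 3, 6, 7)],
    [(-1, 0, 1, 2), (1, 0, 4, 7), (1, 0, 5, 6), (1, 1, 4, 6), (-1, 1, 5, 7), (-1, 2, 4, 5), (-1, 2, 6, 7)],
    [(1, 0, 1, 5), (1, 0, 2, 6), (-1, 0, 3, 7), (-1, 1, 2, 7), (-1, 1, 3, 6), (1, 2, 3, 5), (1, 5, 6, 7)],
    [(-1, 0, 1, 4), (-1, 0, 2, 7), (-1, 0, 3, 6), (-1, 1, 2, 6), (1, 1, 3, 7), (-1, 2, 3, 4), (-1, 4, 6, 7)],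
    [(1, 0, 1, 7), (-1, 0, 2, 4), (1, 0, 3, 5), (1, 1, 2, 5), (1, 1, 3, 4), (1, 2, 3, 7), (1, 4, 5, 7)],
    [(-1, 0, 1, 6), (1, 0, 2, 5), (1, 0, 3, 4), (1, 1, 2, 4), (-1, 1, 3, 5), (-1, 2, 3, 6), (-1, 4, 5, 6)]]

/-- The difference `b - a` of two indices. -/
def gap (a b : Fin 8) : ℤ := ((b : ℕ) : ℤ) - ((a : ℕ) : ℤ)

/-- The product `(i-a)(j-a)(l-a)` for the monomial `(c, i, j, l)`. -/
def gapProd (a : Fin 8) (s : ℤ × Fin 8 × Fin 8 × Fin 8) : ℤ :=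
  gap a s.2.1 * gap a s.2.2.1 * gap a s.2.2.2

/-- Multiplication with a shortcut for the first factor `0`. -/
def lazyMul (a b : ℤ) : ℤ := if a = 0 then 0 else a * b

/-- The signed Vandermonde product `c (j-i)(l-i)(l-j)` of the monomial `(c, i, j, l)`, multiplied
by its differences from `p` and `q`. -/
def termWeight (p q : Fin 8) (s : ℤ × Fin 8 × Fin 8 × Fin 8) : ℤ :=
  lazyMul (gapProd p s) (lazyMul (gapProd q s)
    (s.1 * gap s.2.1 s.2.2.1 * gap s.2.1 s.2.2.2 * gap s.2.2.1 s.2.2.2))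

/-- The integer `1! 2! ⋯ 7!` times the coefficient of `u i * v j * y k * w l` in the scalar
`(u♭ ∧ v♭) ∧ (ι_y Φ₀) ∧ (ι_w Φ₀) / vol`. -/
def wedgeCoeff (i j k l : Fin 8) : ℤ :=
  lazyMul (gap i j) ((contractionTerms k).map fun s => lazyMul (termWeight i j s)
    ((contractionTerms l).map fun t => lazyMul (termWeight i j t)
      (lazyMul (gapProd s.2.1 t) (lazyMul (gapProd s.2.2.1 t) (gapProd s.2.2.2 t)))).sum).sum

/-- The Kronecker symbol with values in `ℤ`. -/
def kronecker (i j : Fin 8) : ℤ := if i = j then 1 else 0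

/-- The value of `dx^a ∧ dx^b ∧ dx^c` on the basis vectors `e_i, e_j, e_k`. -/
def kronecker3 (a b c i j k : Fin 8) : ℤ :=
  kronecker a i * (kronecker b j * kronecker c k - kronecker c j * kronecker b k)
    - kronecker b i * (kronecker a j * kronecker c k - kronecker c j * kronecker a k)
    + kronecker c i * (kronecker a j * kronecker b k - kronecker b j * kronecker a k)

/-- The component of `Φ₀` on the basis vectors `e_i, e_j, e_k, e_l`. -/
def cayleyCoeff (i j k l : Fin 8) : ℤ :=
  ((contractionTerms i).map fun s => s.1 * kronecker3 s.2.1 s.2.2.1 s.2.2.2 j k l).sum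

theorem wedgeCoeff_eq : ∀ i j k l : Fin 8, wedgeCoeff i j k l = 125411328000 *
    (-4 * (kronecker i k * kronecker j l - kronecker i l * kronecker j k)
      + 2 * cayleyCoeff i j k l) := by
  decide +kernel

/-- The decomposable `n`-form `⟨r₀, ·⟩ ∧ ⋯ ∧ ⟨r_{n-1}, ·⟩`. -/
def decomposableForm {n : ℕ} (r z : Fin n → E8) : ℝ :=
  Matrix.det (Matrix.of fun a b => ⟪r a, z b⟫)

theorem sum_map_finset_sum {α ι : Type*} (L : List α) (t : Finset ι) (f : α → ι → ℝ) :
    (L.map fun s => ∑ i ∈ t, f s i).sum = ∑ i ∈ t, (L.map fun s => f s i).sum := by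
  induction L with
  | nil => simp
  | cons s L ih => simp [ih, Finset.sum_add_distrib]

/-- The wedge product as a bilinear map. -/
def wedgeBilin (p q : ℕ) : ((Fin p → E8) → ℝ) →ₗ[ℝ] ((Fin q → E8) → ℝ) →ₗ[ℝ]
    ((Fin (p + q) → E8) → ℝ) :=
  LinearMap.mk₂ ℝ wedge
    (fun f f' g => by
      ext v; simp only [wedge, Pi.add_apply, add_mul, mul_add, Finset.sum_add_distrib])
    (fun c f g => by
      ext v
      simp only [wedge, Pi.smul_apply, smul_eq_mul, Finset.mul_sum]
      exact Finset.sum_congr rfl fun σ _ => by ring)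
    (fun f g g' => by
      ext v; simp only [wedge, Pi.add_apply, mul_add, Finset.sum_add_distrib])
    (fun c f g => by
      ext v
      simp only [wedge, Pi.smul_apply, smul_eq_mul, Finset.mul_sum]
      exact Finset.sum_congr rfl fun σ _ => by ring)

theorem wedge_decomposableForm {p q : ℕ} (r : Fin p → E8) (s : Fin q → E8) :
    wedge (decomposableForm r) (decomposableForm s) = decomposableForm (Fin.append r s) := by
  ext v
  have key (τ : Equiv.Perm (Fin p)) (ρ : Equiv.Perm (Fin q)) :
      ∑ σ : Equiv.Perm (Fin (p + q)), ((Equiv.Perm.sign σ : ℤ) : ℝ) *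
        ((((Equiv.Perm.sign τ : ℤ) : ℝ) * ∏ i, ⟪r i, v (σ (Fin.castAdd q (τ i)))⟫) *
          (((Equiv.Perm.sign ρ : ℤ) : ℝ) * ∏ j, ⟪s j, v (σ (Fin.natAdd p (ρ j)))⟫)) =
      decomposableForm (Fin.append r s) v := by
    rw [decomposableForm, ← Matrix.det_transpose, Matrix.det_apply']
    refine Fintype.sum_equiv
      (Equiv.mulRight (finSumFinEquiv.permCongr (Equiv.Perm.sumCongr τ ρ))) _ _ fun σ => ?_
    simp [Fin.prod_univ_add, Equiv.permCongr_apply]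
    ring
  have expand {n : ℕ} (r z : Fin n → E8) : decomposableForm r z =
      ∑ τ : Equiv.Perm (Fin n), ((Equiv.Perm.sign τ : ℤ) : ℝ) * ∏ i, ⟪r i, z (τ i)⟫ := by
    rw [decomposableForm, ← Matrix.det_transpose, Matrix.det_apply']
    rfl
  simp only [wedge, expand r, expand s, Finset.sum_mul_sum]
  simp only [Finset.mul_sum (_ : Finset (Equiv.Perm (Fin p))),
    Finset.mul_sum (_ : Finset (Equiv.Perm (Fin q)))]
  rw [Finset.sum_comm]
  simp_rw [Finset.sum_comm (s := (Finset.univ : Finset (Equiv.Perm (Fin (p + q))))), key]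
  simp [Fintype.card_perm]
  field_simp

theorem decomposableForm_eq_det_mul_vol (r vv : Fin 8 → E8) :
    decomposableForm r vv = Matrix.det (Matrix.of fun a b => r a b) * vol vv := by
  rw [vol, ← Matrix.det_mul, decomposableForm]
  congr 1
  ext a b
  simp [Matrix.mul_apply, PiLp.inner_apply, mul_comm]

/-- The standard basis vector `e_i`. -/
def stdVec (i : Fin 8) : E8 := EuclideanSpace.single i 1

/-- The decomposable form `dx^i ∧ dx^j ∧ dx^l`. -/
def monomialForm (s : Fin 8 × Fin 8 × Fin 8) : (Fin 3 → E8) → ℝ :=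
  decomposableForm ![stdVec s.1, stdVec s.2.1, stdVec s.2.2]

theorem dx4_cons (i j k l : Fin 8) (y a b c : E8) : dx4 i j k l ![y, a, b, c] =
    y i * monomialForm (j, k, l) ![a, b, c] - y j * monomialForm (i, k, l) ![a, b, c]
      + y k * monomialForm (i, j, l) ![a, b, c] - y l * monomialForm (i, j, k) ![a, b, c] := by
  simp [dx4, monomialForm, decomposableForm, stdVec, EuclideanSpace.inner_single_left,
    Matrix.det_succ_column_zero, Fin.sum_univ_succ, Fin.succAbove]
  ring

theorem Phi0_eq_sum (y a b c : E8) : Phi0 ![y, a, b, c] =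
    ∑ k, y k * ((contractionTerms k).map fun s => s.1 * monomialForm s.2 ![a, b, c]).sum := by
  simp [Phi0, dx4_cons, contractionTerms, Fin.sum_univ_eight]
  ring

theorem iota1_eq_sum (y : E8) : iota1 y =
    ∑ k, y k • ((contractionTerms k).map fun s => (s.1 : ℝ) • monomialForm s.2).sum := by
  ext z
  have hz : ![z 0, z 1, z 2] = z := by ext i; fin_cases i <;> rfl
  rw [iota1, Phi0_eq_sum, hz]
  simp [Pi.list_sum_apply, Function.comp_def]

theorem flat_eq_decomposableForm (u : E8) : flat u = decomposableForm ![u] := by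
  ext z
  simp [flat, decomposableForm]

/-- The determinant of the matrix with rows `r`. -/
def rowDet (r : Fin 8 → E8) : ℝ := Matrix.det (Matrix.of fun a b => r a b)

theorem rowDet_cons (u : E8) (r : Fin 7 → E8) :
    rowDet (Fin.cons u r) = ∑ i, u i * rowDet (Fin.cons (stdVec i) r) := by
  have h (u : E8) : rowDet (Fin.cons u r) = ∑ i : Fin 8, (-1) ^ (i : ℕ) * u i *
      Matrix.det (Matrix.of fun a b => r a (i.succAbove b)) :=
    Matrix.det_succ_row_zero _
  simp only [h]
  refine Finset.sum_congr rfl fun i _ => ?_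
  simp [stdVec]
  ring

theorem rowDet_swap (u v : E8) (r : Fin 6 → E8) :
    rowDet (Fin.cons u (Fin.cons v r)) = -rowDet (Fin.cons v (Fin.cons u r)) := by
  have h := Matrix.det_permute (Equiv.swap (0 : Fin 8) 1)
    (Matrix.of fun a b => (Fin.cons v (Fin.cons u r) : Fin 8 → E8) a b)
  rw [Equiv.Perm.sign_swap (by decide)] at h
  simp only [Units.val_neg, Units.val_one, Int.cast_neg, Int.cast_one, neg_one_mul] at h
  rw [rowDet, rowDet, ← h]
  congr 1
  ext a b
  fin_cases a <;> rfl

theorem rowDet_cons_cons (u v : E8) (r : Fin 6 → E8) :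
    rowDet (Fin.cons u (Fin.cons v r)) =
      ∑ i, ∑ j, u i * v j * rowDet (Fin.cons (stdVec i) (Fin.cons (stdVec j) r)) := by
  rw [rowDet_cons]
  refine Finset.sum_congr rfl fun i _ => ?_
  rw [rowDet_swap, rowDet_cons, ← Finset.sum_neg_distrib, Finset.mul_sum]
  refine Finset.sum_congr rfl fun j _ => ?_
  rw [rowDet_swap]
  ring

theorem rowDet_stdVec (f : Fin 8 → Fin 8) :
    125411328000 * rowDet (fun a => stdVec (f a)) = ∏ i, ∏ j ∈ Finset.Ioi i, (gap (f i) (f j) : ℝ) := by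
  have h : ∏ i, ∏ j ∈ Finset.Ioi i, (gap (f i) (f j) : ℝ) =
      Matrix.det (Matrix.vandermonde fun i => ((f i : ℕ) : ℝ)) := by
    simp [Matrix.det_vandermonde, gap]
  have hmul : Matrix.vandermonde (fun i => ((f i : ℕ) : ℝ)) =
      (Matrix.of fun a b => stdVec (f a) b) * Matrix.vandermonde fun i : Fin 8 => ((i : ℕ) : ℝ) := by
    ext a b
    simp [Matrix.mul_apply, Matrix.vandermonde_apply, stdVec]
  rw [h, hmul, Matrix.det_mul, rowDet, mul_comm]
  congr 1
  rw [Matrix.det_vandermonde]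
  simp [Fin.prod_univ_succ, Fin.prod_Ioi_succ]
  norm_num

theorem lazyMul_eq_mul (a b : ℤ) : lazyMul a b = a * b := by
  simp +contextual [lazyMul]

theorem rowDet_monomials (i j : Fin 8) (s t : ℤ × Fin 8 × Fin 8 × Fin 8) :
    125411328000 * (s.1 * t.1 * rowDet ![stdVec i, stdVec j, stdVec s.2.1, stdVec s.2.2.1,
      stdVec s.2.2.2, stdVec t.2.1, stdVec t.2.2.1, stdVec t.2.2.2]) =
    ((gap i j * (termWeight i j s * (termWeight i j t *
      (gapProd s.2.1 t * (gapProd s.2.2.1 t * gapProd s.2.2.2 t)))) : ℤ) : ℝ) := by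
  have h := rowDet_stdVec ![i, j, s.2.1, s.2.2.1, s.2.2.2, t.2.1, t.2.2.1, t.2.2.2]
  have hr : (fun a => stdVec (![i, j, s.2.1, s.2.2.1, s.2.2.2, t.2.1, t.2.2.1, t.2.2.2] a)) =
      ![stdVec i, stdVec j, stdVec s.2.1, stdVec s.2.2.1, stdVec s.2.2.2, stdVec t.2.1,
        stdVec t.2.2.1, stdVec t.2.2.2] := by
    ext a; fin_cases a <;> rfl
  rw [hr] at h
  rw [mul_left_comm, h]
  simp [Fin.prod_univ_succ, Fin.prod_Ioi_succ, termWeight, lazyMul_eq_mul, gapProd]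
  ring

theorem sum_rowDet_eq_wedgeCoeff (i j k l : Fin 8) :
    125411328000 * ((contractionTerms k).map fun s => ((contractionTerms l).map fun t =>
      s.1 * t.1 * rowDet ![stdVec i, stdVec j, stdVec s.2.1, stdVec s.2.2.1,
        stdVec s.2.2.2, stdVec t.2.1, stdVec t.2.2.1, stdVec t.2.2.2]).sum).sum =
    (wedgeCoeff i j k l : ℝ) := by
  simp only [← List.sum_map_mul_left, rowDet_monomials, wedgeCoeff, lazyMul_eq_mul]
  simp only [Int.cast_list_sum, List.map_map, Function.comp_def]

theorem monomialForm_eq_sum (s : Fin 8 × Fin 8 × Fin 8) (v y w : E8) :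
    monomialForm s ![v, y, w] = ∑ j, ∑ k, ∑ l, v j * y k * w l *
      (kronecker3 s.1 s.2.1 s.2.2 j k l : ℝ) := by
  simp [monomialForm, decomposableForm, Matrix.det_fin_three, stdVec,
    EuclideanSpace.inner_single_left, kronecker3, kronecker, mul_add, mul_sub,
    Finset.sum_add_distrib, Finset.sum_sub_distrib]
  ring

theorem Phi0_eq_sum_cayleyCoeff (u v y w : E8) : Phi0 ![u, v, y, w] =
    ∑ i, ∑ j, ∑ k, ∑ l, u i * v j * y k * w l * (cayleyCoeff i j k l : ℝ) := by
  rw [Phi0_eq_sum]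
  refine Finset.sum_congr rfl fun i _ => ?_
  simp only [monomialForm_eq_sum, cayleyCoeff, Int.cast_list_sum, List.map_map, Function.comp_def,
    Int.cast_mul]
  induction contractionTerms i with
  | nil => simp
  | cons s L ih =>
    simp only [List.map_cons, List.sum_cons, mul_add, Finset.sum_add_distrib, ih]
    congr 1
    simp only [Finset.mul_sum]
    refine Finset.sum_congr rfl fun j _ => Finset.sum_congr rfl fun k _ =>
      Finset.sum_congr rfl fun l _ => ?_
    ring

theorem linearMap_iota1 (φ : ((Fin 3 → E8) → ℝ) →ₗ[ℝ] ℝ) (y : E8) : φ (iota1 y) =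
    ∑ k, y k * ((contractionTerms k).map fun s => s.1 * φ (monomialForm s.2)).sum := by
  simp only [iota1_eq_sum, map_sum, map_smul, map_list_sum, List.map_map, Function.comp_def,
    smul_eq_mul]

theorem wedge_eq_sum (u v y w : E8) (vv : Fin 8 → E8) :
    wedge (wedge (flat u) (flat v)) (wedge (iota1 y) (iota1 w)) vv =
    (∑ k, ∑ l, y k * w l * ((contractionTerms k).map fun s => ((contractionTerms l).map fun t =>
      (s.1 : ℝ) * t.1 * rowDet ![u, v, stdVec s.2.1, stdVec s.2.2.1,
        stdVec s.2.2.2, stdVec t.2.1, stdVec t.2.2.1, stdVec t.2.2.2]).sum).sum) * vol vv := by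
  let B : ((Fin 3 → E8) → ℝ) →ₗ[ℝ] ((Fin 3 → E8) → ℝ) →ₗ[ℝ] ℝ :=
    (wedgeBilin 3 3).compr₂
      ((LinearMap.proj vv).comp (wedgeBilin (1 + 1) (3 + 3) (wedge (flat u) (flat v))))
  have hterm (s t : Fin 8 × Fin 8 × Fin 8) : B (monomialForm s) (monomialForm t) =
      rowDet ![u, v, stdVec s.1, stdVec s.2.1, stdVec s.2.2, stdVec t.1, stdVec t.2.1,
        stdVec t.2.2] * vol vv := by
    change wedge (wedge (flat u) (flat v)) (wedge (monomialForm s) (monomialForm t)) vv = _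
    rw [flat_eq_decomposableForm, flat_eq_decomposableForm, monomialForm, monomialForm,
      wedge_decomposableForm, wedge_decomposableForm, wedge_decomposableForm]
    refine Eq.trans ?_ (decomposableForm_eq_det_mul_vol _ vv)
    refine congrArg (fun r => decomposableForm (n := 8) r vv) ?_
    funext a
    fin_cases a <;> rfl
  change B.flip (iota1 w) (iota1 y) = _
  rw [linearMap_iota1]
  simp only [LinearMap.flip_apply, linearMap_iota1 (B _), hterm, Finset.mul_sum, Finset.sum_mul,
    sum_map_finset_sum, ← List.sum_map_mul_left, ← List.sum_map_mul_right]
  refine Finset.sum_congr rfl fun k _ => Finset.sum_congr rfl fun l _ => ?_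
  congr! 5
  funext t
  ring

theorem wedge_eq_sum_wedgeCoeff (u v y w : E8) (vv : Fin 8 → E8) :
    125411328000 * wedge (wedge (flat u) (flat v)) (wedge (iota1 y) (iota1 w)) vv =
    (∑ i, ∑ j, ∑ k, ∑ l, u i * v j * y k * w l * (wedgeCoeff i j k l : ℝ)) * vol vv := by
  have hrow (a b c d e g : E8) : rowDet ![u, v, a, b, c, d, e, g] =
      ∑ i, ∑ j, u i * v j * rowDet ![stdVec i, stdVec j, a, b, c, d, e, g] :=
    rowDet_cons_cons u v ![a, b, c, d, e, g]
  have hcomm (F : Fin 8 → Fin 8 → Fin 8 → Fin 8 → ℝ) :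
      ∑ k, ∑ l, ∑ i, ∑ j, F i j k l = ∑ i, ∑ j, ∑ k, ∑ l, F i j k l := by
    have h := Finset.sum_comm (s := Finset.univ) (t := Finset.univ)
      (f := fun p q : Fin 8 × Fin 8 => F q.1 q.2 p.1 p.2)
    simpa only [Fintype.sum_prod_type] using h
  rw [wedge_eq_sum, ← mul_assoc]
  congr 1
  simp only [hrow, Finset.mul_sum, sum_map_finset_sum, ← sum_rowDet_eq_wedgeCoeff]
  rw [hcomm]
  refine Finset.sum_congr rfl fun i _ => Finset.sum_congr rfl fun j _ =>
    Finset.sum_congr rfl fun k _ => Finset.sum_congr rfl fun l _ => ?_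
  simp only [← List.sum_map_mul_left]
  congr! 5
  funext t
  ring

/-- For all `u, v, y, w ∈ ℝ⁸`, with `A = ⟨u,y⟩⟨v,w⟩ − ⟨u,w⟩⟨v,y⟩` and
`B = Φ₀(u,v,y,w)`, one has `(u♭ ∧ v♭) ∧ (ι_y Φ₀) ∧ (ι_w Φ₀) = (−4A + 2B) · vol`. -/
theorem flat_wedge_contraction_wedge_contraction (u v y w : E8) (vv : Fin 8 → E8) :
    wedge (wedge (flat u) (flat v)) (wedge (iota1 y) (iota1 w)) vv =
      (-4 * (⟪u, y⟫ * ⟪v, w⟫ - ⟪u, w⟫ * ⟪v, y⟫) + 2 * Phi0 ![u, v, y, w]) * vol vv := by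
  have hRHS : (∑ i, ∑ j, ∑ k, ∑ l, u i * v j * y k * w l * (wedgeCoeff i j k l : ℝ)) =
      125411328000 * (-4 * (⟪u, y⟫ * ⟪v, w⟫ - ⟪u, w⟫ * ⟪v, y⟫) + 2 * Phi0 ![u, v, y, w]) := by
    have h₁ : ⟪u, y⟫ * ⟪v, w⟫ = ∑ i, ∑ j, ∑ k, ∑ l, u i * v j * y k * w l *
        ((kronecker i k : ℝ) * kronecker j l) := by
      simp [kronecker, PiLp.inner_apply, Finset.sum_mul_sum]
      exact Finset.sum_congr rfl fun i _ => Finset.sum_congr rfl fun j _ => by ring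
    have h₂ : ⟪u, w⟫ * ⟪v, y⟫ = ∑ i, ∑ j, ∑ k, ∑ l, u i * v j * y k * w l *
        ((kronecker i l : ℝ) * kronecker j k) := by
      simp [kronecker, PiLp.inner_apply, Finset.sum_mul_sum]
      exact Finset.sum_congr rfl fun i _ => Finset.sum_congr rfl fun j _ => by ring
    rw [h₁, h₂, Phi0_eq_sum_cayleyCoeff]
    simp only [wedgeCoeff_eq, Finset.mul_sum, ← Finset.sum_sub_distrib, ← Finset.sum_add_distrib]
    refine Finset.sum_congr rfl fun i _ => Finset.sum_congr rfl fun j _ =>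
      Finset.sum_congr rfl fun k _ => Finset.sum_congr rfl fun l _ => ?_
    push_cast
    ring
  have h := wedge_eq_sum_wedgeCoeff u v y w vv
  rw [hRHS, mul_assoc] at h
  exact mul_left_cancel₀ (by norm_num) h
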